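/- (Probability suppression at first valid occurrence.) Let n ≥ 1, T ≥ 0, and let z : ℕ → Fin n → ℝ be a sequence of logit vectors such that z 0 is a constant function (uniform initialization), and for every τ < T: (i) ∑_{j ∈ Fin n} (z (τ+1) j − z τ j) = 0 (zero-sum logit updates), and (ii) z (τ+1) a − z τ a = −κ τ for a fixed action a ∈ Fin n, where κ τ > 0 (per-step suppression rate). Let K_T = ∑_{τ < T} κ τ. Then the softmax probability of a at time T satisfies Real.exp (z T a) / ∑_{j ∈ Fin n} Real.exp (z T j) ≤ Real.exp (−K_T) / n. -/

import Mathlib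

/-- The sum of exponentials is at least its value at the mean. -/
theorem card_mul_exp_le_sum_exp {ι : Type*} [Fintype ι] (x : ι → ℝ) (c : ℝ)
    (hx : ∑ j, (x j - c) = 0) :
    (Fintype.card ι : ℝ) * Real.exp c ≤ ∑ j, Real.exp (x j) := by
  calc (Fintype.card ι : ℝ) * Real.exp c
      = ∑ j, Real.exp c * ((x j - c) + 1) := by
        rw [← Finset.mul_sum, Finset.sum_add_distrib, hx]
        simp [mul_comm]
    _ ≤ ∑ j, Real.exp (x j) := by
        refine Finset.sum_le_sum fun j _ => ?_
        calc Real.exp c * ((x j - c) + 1) ≤ Real.exp c * Real.exp (x j - c) := by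
              gcongr
              exact Real.add_one_le_exp _
          _ = Real.exp (x j) := by rw [← Real.exp_add, add_sub_cancel]

/-- Probability suppression at first valid occurrence: starting from a constant
(uniform-initialization) logit vector, with zero-sum logit updates at every step
`τ < T` and per-step suppression `z (τ+1) a − z τ a = −κ τ` with `κ τ > 0` on
action `a`, the softmax probability of `a` at time `T` is at most
`exp (−K_T) / n` where `K_T = ∑_{τ < T} κ τ`. -/
theorem probability_suppression (n : ℕ) (hn : 1 ≤ n) (T : ℕ)
    (z : ℕ → Fin n → ℝ) (c₀ : ℝ) (hz0 : ∀ j, z 0 j = c₀)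
    (a : Fin n) (κ : ℕ → ℝ) (hκ : ∀ τ < T, 0 < κ τ)
    (hzero : ∀ τ < T, ∑ j : Fin n, (z (τ + 1) j - z τ j) = 0)
    (hsupp : ∀ τ < T, z (τ + 1) a - z τ a = -κ τ) :
    Real.exp (z T a) / ∑ j : Fin n, Real.exp (z T j)
      ≤ Real.exp (-(∑ τ ∈ Finset.range T, κ τ)) / n := by
  have hn' : (0 : ℝ) < n := by exact_mod_cast hn
  have ha : z T a = c₀ + -∑ τ ∈ Finset.range T, κ τ := by
    rw [← Finset.sum_neg_distrib,
      ← Finset.sum_congr rfl fun τ hτ => hsupp τ (Finset.mem_range.mp hτ),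
      Finset.sum_range_sub (fun τ => z τ a), hz0 a, add_sub_cancel]
  have hsum : ∑ j, (z T j - c₀) = 0 := by
    calc ∑ j, (z T j - c₀) = ∑ j, ∑ τ ∈ Finset.range T, (z (τ + 1) j - z τ j) := by
          refine Finset.sum_congr rfl fun j _ => ?_
          rw [Finset.sum_range_sub (fun τ => z τ j), hz0 j]
      _ = 0 := by
          rw [Finset.sum_comm]
          exact Finset.sum_eq_zero fun τ hτ => hzero τ (Finset.mem_range.mp hτ)
  have hpart : (n : ℝ) * Real.exp c₀ ≤ ∑ j, Real.exp (z T j) := by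
    simpa using card_mul_exp_le_sum_exp (z T) c₀ hsum
  calc Real.exp (z T a) / ∑ j, Real.exp (z T j)
      ≤ Real.exp (z T a) / (n * Real.exp c₀) := by gcongr
    _ = Real.exp (-(∑ τ ∈ Finset.range T, κ τ)) / n := by
        rw [ha, Real.exp_add]
        field_simp
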